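/- arXiv:1505.03134 — 7 statements merged into one kernel-verified Lean document; each statement's English description precedes it below -/
import Mathlib

section
/- Let 𝕋 be a time scale, α ∈ (0,1], f : 𝕋 → ℝ, and t ∈ 𝕋 with t > 0. If f is conformable fractional differentiable of order α at t (i.e., there exists a real number L with T_α(f)(t) = L), then f is continuous at t (with respect to the subspace topology of 𝕋 ⊆ ℝ). -/
open Real Filter Set
open scoped Classical

/-- Forward jump operator of a time scale `T ⊆ ℝ`:
`σ(t) = inf {s ∈ T | t < s}`, with `σ(t) = t` if this set is empty. -/
noncomputable def tsSigma (T : Set ℝ) (t : ℝ) : ℝ :=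
  if ({s | s ∈ T ∧ t < s}).Nonempty then sInf {s | s ∈ T ∧ t < s} else t

/-- Graininess function `μ(t) = σ(t) − t`. -/
noncomputable def tsMu (T : Set ℝ) (t : ℝ) : ℝ := tsSigma T t - t

/-- `L` is the conformable fractional derivative of order `α` of `f` at `t` on the
time scale `T`: for every `ε > 0` there is `δ > 0` such that
`|(f(σ(t)) − f(s))·t^(1−α) − L·(σ(t) − s)| ≤ ε·|σ(t) − s|`
for all `s ∈ T` with `|t − s| < δ`. -/
def HasConfDeriv (T : Set ℝ) (α : ℝ) (f : ℝ → ℝ) (t L : ℝ) : Prop :=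
  ∀ ε > 0, ∃ δ > 0, ∀ s ∈ T, |t - s| < δ →
    |(f (tsSigma T t) - f s) * t ^ (1 - α) - L * (tsSigma T t - s)| ≤
      ε * |tsSigma T t - s|

/-- The error term in the conformable derivative tends to `0` along `T`. -/
theorem HasConfDeriv.tendsto_error {T : Set ℝ} {α : ℝ} {f : ℝ → ℝ} {t L : ℝ}
    (h : HasConfDeriv T α f t L) :
    Tendsto (fun s => (f (tsSigma T t) - f s) * t ^ (1 - α) - L * (tsSigma T t - s))
      (nhdsWithin t T) (nhds 0) := by
  rw [Metric.tendsto_nhdsWithin_nhds]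
  intro ε hε
  have hC : 0 < |tsSigma T t - t| + 1 := by positivity
  obtain ⟨δ, hδ, H⟩ := h (ε / 2 / (|tsSigma T t - t| + 1)) (by positivity)
  refine ⟨min δ 1, by positivity, fun s hs hst => ?_⟩
  rw [dist_comm, Real.dist_eq, lt_min_iff] at hst
  have hbound : |tsSigma T t - s| ≤ |tsSigma T t - t| + 1 :=
    (abs_sub_le _ t _).trans (by linarith)
  rw [Real.dist_eq, sub_zero]
  calc _ ≤ ε / 2 / (|tsSigma T t - t| + 1) * |tsSigma T t - s| := H s hs hst.1
    _ ≤ ε / 2 / (|tsSigma T t - t| + 1) * (|tsSigma T t - t| + 1) := by gcongr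
    _ = ε / 2 := div_mul_cancel₀ _ hC.ne'
    _ < ε := half_lt_self hε

theorem stmt0 (T : Set ℝ) (hTne : T.Nonempty) (hTcl : IsClosed T)
    (α : ℝ) (hα : α ∈ Set.Ioc (0 : ℝ) 1)
    (f : ℝ → ℝ) (t : ℝ) (ht : t ∈ T) (ht0 : 0 < t)
    (hdiff : ∃ L, HasConfDeriv T α f t L) :
    ContinuousWithinAt f T t := by
  obtain ⟨L, hL⟩ := hdiff
  have hc : t ^ (1 - α) ≠ 0 := (Real.rpow_pos_of_pos ht0 _).ne'
  set g : ℝ → ℝ := fun s => (f (tsSigma T t) - f s) * t ^ (1 - α) - L * (tsSigma T t - s)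
    with hg
  have hlim : Tendsto g (nhdsWithin t T) (nhds 0) := hL.tendsto_error
  have hgt : g t = 0 := (tendsto_nhds_unique (hlim.mono_left (pure_le_nhdsWithin ht)) (tendsto_pure_nhds g t)).symm
  have hgc : ContinuousWithinAt g T t := by rwa [ContinuousWithinAt, hgt]
  have hf : f = fun s => f (tsSigma T t) - (g s + L * (tsSigma T t - s)) / t ^ (1 - α) := by
    funext s
    simp only [hg]
    field_simp
    ring
  rw [hf]
  exact continuousWithinAt_const.sub ((hgc.add (by fun_prop)).div_const _)
end

section
/- Let 𝕋 be a time scale, α ∈ (0,1], f : 𝕋 → ℝ, and t ∈ 𝕋 with t > 0. If f is continuous at t (in the subspace topology of 𝕋) and t is right-scattered, then f is conformable fractional differentiable of order α at t with T_α(f)(t) = ((f(σ(t)) − f(t))/μ(t))·t^{1−α}. -/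
open Real Filter Set
open scoped Classical

theorem stmt1 (T : Set ℝ) (hTne : T.Nonempty) (hTcl : IsClosed T)
    (α : ℝ) (hα : α ∈ Set.Ioc (0 : ℝ) 1)
    (f : ℝ → ℝ) (t : ℝ) (ht : t ∈ T) (ht0 : 0 < t)
    (hcont : ContinuousWithinAt f T t) (hrs : t < tsSigma T t) :
    HasConfDeriv T α f t ((f (tsSigma T t) - f t) / tsMu T t * t ^ (1 - α)) := by
  have hμ : tsMu T t ≠ 0 := (sub_pos.2 hrs).ne'
  intro ε hε
  set L := (f (tsSigma T t) - f t) / tsMu T t * t ^ (1 - α) with hL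
  have hid : ContinuousWithinAt (fun s : ℝ => tsSigma T t - s) T t := by fun_prop
  have hleft : ContinuousWithinAt
      (fun s => |(f (tsSigma T t) - f s) * t ^ (1 - α) - L * (tsSigma T t - s)|) T t :=
    (((continuousWithinAt_const.sub hcont).mul continuousWithinAt_const).sub
      (continuousWithinAt_const.mul hid)).abs
  have hright : ContinuousWithinAt (fun s => ε * |tsSigma T t - s|) T t :=
    continuousWithinAt_const.mul hid.abs
  have hzero : (f (tsSigma T t) - f t) * t ^ (1 - α) - L * (tsSigma T t - t) = 0 := by
    rw [hL, ← tsMu]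
    field_simp
    ring
  have hlt : |(f (tsSigma T t) - f t) * t ^ (1 - α) - L * (tsSigma T t - t)| <
      ε * |tsSigma T t - t| := by
    rw [hzero, abs_zero]
    exact mul_pos hε (abs_pos.2 hμ)
  obtain ⟨δ, hδ, hball⟩ := Metric.mem_nhdsWithin_iff.1 (hleft.eventually_lt hright hlt)
  refine ⟨δ, hδ, fun s hs hts => le_of_lt (hball ⟨?_, hs⟩)⟩
  rwa [Metric.mem_ball, dist_comm, Real.dist_eq]
end

section
/- Let 𝕋 be a time scale, α ∈ (0,1], f, g : 𝕋 → ℝ continuous (in the subspace topology of 𝕋), and t ∈ 𝕋 with t > 0. If f and g are conformable fractional differentiable of order α at t, then the product fg is conformable fractional differentiable of order α at t with T_α(fg)(t) = T_α(f)(t)·g(t) + f(σ(t))·T_α(g)(t), and also T_α(fg)(t) = T_α(f)(t)·g(σ(t)) + f(t)·T_α(g)(t). -/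
open Real Filter Set
open scoped Classical

/-- Product rule for the conformable derivative on a time scale; only continuity of the second
factor at `t` is needed. -/
theorem HasConfDeriv.mul {T : Set ℝ} {α : ℝ} {f g : ℝ → ℝ} {t Lf Lg : ℝ}
    (hf : HasConfDeriv T α f t Lf) (hg : HasConfDeriv T α g t Lg)
    (hgc : ContinuousWithinAt g T t) :
    HasConfDeriv T α (fun s => f s * g s) t (Lf * g t + f (tsSigma T t) * Lg) := by
  intro ε hε
  set u := tsSigma T t with hu
  set C := |g t| + 1 + |f u| + |Lf| with hC
  have hCpos : 0 < C := by positivity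
  obtain ⟨η, hη, hη1, hηC⟩ : ∃ η > 0, η ≤ 1 ∧ η * C ≤ ε :=
    ⟨min 1 (ε / C), by positivity, min_le_left _ _,
      (le_div_iff₀ hCpos).1 (min_le_right _ _)⟩
  obtain ⟨δ₁, hδ₁, h₁⟩ := hf η hη
  obtain ⟨δ₂, hδ₂, h₂⟩ := hg η hη
  obtain ⟨δ₃, hδ₃, h₃⟩ := Metric.continuousWithinAt_iff.1 hgc η hη
  refine ⟨min δ₁ (min δ₂ δ₃), by positivity, fun s hs hst => ?_⟩
  obtain ⟨hs₁, hs₂, hs₃⟩ : |t - s| < δ₁ ∧ |t - s| < δ₂ ∧ |t - s| < δ₃ := by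
    simpa only [lt_min_iff] using hst
  have hfs := h₁ s hs hs₁
  have hgs := h₂ s hs hs₂
  have hgst : |g s - g t| ≤ η := by
    have := h₃ hs (by rwa [Real.dist_eq, abs_sub_comm])
    rw [Real.dist_eq] at this
    exact this.le
  have hgs_bound : |g s| ≤ |g t| + 1 := by
    linarith [abs_sub_abs_le_abs_sub (g s) (g t)]
  rw [← hu] at hfs hgs
  set p := t ^ (1 - α)
  calc |(f u * g u - f s * g s) * p - (Lf * g t + f u * Lg) * (u - s)|
      = |((f u - f s) * p - Lf * (u - s)) * g s + f u * ((g u - g s) * p - Lg * (u - s))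
          + Lf * (u - s) * (g s - g t)| := by congr 1; ring
    _ ≤ |(f u - f s) * p - Lf * (u - s)| * |g s| + |f u| * |(g u - g s) * p - Lg * (u - s)|
          + |Lf| * |u - s| * |g s - g t| := by
        simpa only [abs_mul] using abs_add_three
          (((f u - f s) * p - Lf * (u - s)) * g s) (f u * ((g u - g s) * p - Lg * (u - s)))
          (Lf * (u - s) * (g s - g t))
    _ ≤ η * |u - s| * (|g t| + 1) + |f u| * (η * |u - s|) + |Lf| * |u - s| * η := by gcongr
    _ = η * C * |u - s| := by rw [hC]; ring
    _ ≤ ε * |u - s| := by gcongr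

theorem stmt10 (T : Set ℝ) (hTne : T.Nonempty) (hTcl : IsClosed T)
    (α : ℝ) (hα : α ∈ Set.Ioc (0 : ℝ) 1)
    (f g : ℝ → ℝ) (hfc : ContinuousOn f T) (hgc : ContinuousOn g T)
    (t : ℝ) (ht : t ∈ T) (ht0 : 0 < t)
    (Lf Lg : ℝ) (hdf : HasConfDeriv T α f t Lf) (hdg : HasConfDeriv T α g t Lg) :
    HasConfDeriv T α (fun s => f s * g s) t (Lf * g t + f (tsSigma T t) * Lg) ∧
    HasConfDeriv T α (fun s => f s * g s) t (Lf * g (tsSigma T t) + f t * Lg) := by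
  refine ⟨hdf.mul hdg (hgc t ht), ?_⟩
  have h := hdg.mul hdf (hfc t ht)
  simpa only [mul_comm, add_comm] using h
end

section
/- Let 𝕋 be a time scale, α ∈ (0,1], f : 𝕋 → ℝ continuous (in the subspace topology of 𝕋), and t ∈ 𝕋 with t > 0. If f is conformable fractional differentiable of order α at t and f(t)·f(σ(t)) ≠ 0, then the function 1/f is conformable fractional differentiable of order α at t with T_α(1/f)(t) = −T_α(f)(t)/(f(t)·f(σ(t))). -/
open Real Filter Set
open scoped Classical

theorem hasConfDeriv_iff_eventually {T : Set ℝ} {α : ℝ} {f : ℝ → ℝ} {t L : ℝ} :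
    HasConfDeriv T α f t L ↔ ∀ ε > 0, ∀ᶠ s in nhdsWithin t T,
      |(f (tsSigma T t) - f s) * t ^ (1 - α) - L * (tsSigma T t - s)| ≤
        ε * |tsSigma T t - s| := by
  simp only [HasConfDeriv, eventually_nhdsWithin_iff, Metric.eventually_nhds_iff, Real.dist_eq]
  refine forall₂_congr fun ε _ => exists_congr fun δ => and_congr_right fun _ => ?_
  exact forall_congr' fun s => by rw [abs_sub_comm t s]; exact forall_comm

theorem stmt11 (T : Set ℝ) (hTne : T.Nonempty) (hTcl : IsClosed T)
    (α : ℝ) (hα : α ∈ Set.Ioc (0 : ℝ) 1)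
    (f : ℝ → ℝ) (hfc : ContinuousOn f T)
    (t : ℝ) (ht : t ∈ T) (ht0 : 0 < t)
    (Lf : ℝ) (hdf : HasConfDeriv T α f t Lf)
    (hne : f t * f (tsSigma T t) ≠ 0) :
    HasConfDeriv T α (fun s => 1 / f s) t (-(Lf / (f t * f (tsSigma T t)))) := by
  rw [hasConfDeriv_iff_eventually] at hdf ⊢
  intro ε hε
  obtain ⟨hc, ha⟩ := mul_ne_zero_iff.mp hne
  set σ := tsSigma T t
  have hη : 0 < ε * |f t * f σ| / 2 := by positivity
  have hcont : ContinuousWithinAt f T t := hfc t ht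
  have hlim : Tendsto
      (fun s => ε * |f t * f σ| / 2 * |1 / (f σ * f s)| + |Lf / f σ * (1 / f t - 1 / f s)|)
      (nhdsWithin t T)
      (nhds (ε * |f t * f σ| / 2 * |1 / (f σ * f t)| + |Lf / f σ * (1 / f t - 1 / f t)|)) :=
    (((tendsto_const_nhds.div (tendsto_const_nhds.mul hcont) (mul_ne_zero ha hc)).abs).const_mul _).add
      ((tendsto_const_nhds.sub (tendsto_const_nhds.div hcont hc)).const_mul _).abs
  have hlt : ε * |f t * f σ| / 2 * |1 / (f σ * f t)| + |Lf / f σ * (1 / f t - 1 / f t)| < ε := by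
    have h : ε * |f t * f σ| / 2 * |1 / (f σ * f t)| = ε / 2 := by
      rw [mul_comm (f σ), abs_div, abs_one]
      field_simp
    rw [h, sub_self, mul_zero, abs_zero]
    linarith
  filter_upwards [hdf _ hη, hlim.eventually_lt_const hlt, hcont.eventually_ne hc]
    with s hX hs hb
  have key : (1 / f σ - 1 / f s) * t ^ (1 - α) - -(Lf / (f t * f σ)) * (σ - s) =
      Lf / f σ * (1 / f t - 1 / f s) * (σ - s) -
        1 / (f σ * f s) * ((f σ - f s) * t ^ (1 - α) - Lf * (σ - s)) := by
    field_simp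
    ring
  rw [key]
  calc _ ≤ |Lf / f σ * (1 / f t - 1 / f s)| * |σ - s| +
        |1 / (f σ * f s)| * |(f σ - f s) * t ^ (1 - α) - Lf * (σ - s)| := by
        rw [← abs_mul, ← abs_mul]; exact abs_sub _ _
    _ ≤ |Lf / f σ * (1 / f t - 1 / f s)| * |σ - s| +
        |1 / (f σ * f s)| * (ε * |f t * f σ| / 2 * |σ - s|) := by gcongr
    _ = (ε * |f t * f σ| / 2 * |1 / (f σ * f s)| + |Lf / f σ * (1 / f t - 1 / f s)|) *
        |σ - s| := by ring
    _ ≤ ε * |σ - s| := by gcongr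
end

section
/- Let 𝕋 be a time scale, α ∈ (0,1], f, g : 𝕋 → ℝ continuous (in the subspace topology of 𝕋), and t ∈ 𝕋 with t > 0. If f and g are conformable fractional differentiable of order α at t and g(t)·g(σ(t)) ≠ 0, then f/g is conformable fractional differentiable of order α at t with T_α(f/g)(t) = (T_α(f)(t)·g(t) − f(t)·T_α(g)(t))/(g(t)·g(σ(t))). -/
open Real Filter Set
open scoped Classical

open Topology Asymptotics in
/-- The conformable derivative as a little-o statement along `𝓝[T] t`. -/
theorem hasConfDeriv_iff_isLittleO {T : Set ℝ} {α : ℝ} {f : ℝ → ℝ} {t L : ℝ} :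
    HasConfDeriv T α f t L ↔
      (fun s => (f (tsSigma T t) - f s) * t ^ (1 - α) - L * (tsSigma T t - s))
        =o[𝓝[T] t] fun s => tsSigma T t - s := by
  simp only [isLittleO_iff, Real.norm_eq_abs]
  refine forall₂_congr fun ε _ => ?_
  simp only [Metric.nhdsWithin_basis_ball.eventually_iff, Set.mem_inter_iff, Metric.mem_ball',
    Real.dist_eq]
  exact ⟨fun ⟨δ, hδ, h⟩ => ⟨δ, hδ, fun s hs => h s hs.2 hs.1⟩,
    fun ⟨δ, hδ, h⟩ => ⟨δ, hδ, fun s hs hst => h ⟨hst, hs⟩⟩⟩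

theorem stmt12 (T : Set ℝ) (hTne : T.Nonempty) (hTcl : IsClosed T)
    (α : ℝ) (hα : α ∈ Set.Ioc (0 : ℝ) 1)
    (f g : ℝ → ℝ) (hfc : ContinuousOn f T) (hgc : ContinuousOn g T)
    (t : ℝ) (ht : t ∈ T) (ht0 : 0 < t)
    (Lf Lg : ℝ) (hdf : HasConfDeriv T α f t Lf) (hdg : HasConfDeriv T α g t Lg)
    (hne : g t * g (tsSigma T t) ≠ 0) :
    HasConfDeriv T α (fun s => f s / g s) t
      ((Lf * g t - f t * Lg) / (g t * g (tsSigma T t))) := by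
  obtain ⟨hgt, hG⟩ := mul_ne_zero_iff.1 hne
  rw [hasConfDeriv_iff_isLittleO] at hdf hdg ⊢
  set G := g (tsSigma T t)
  have hf : Filter.Tendsto f (nhdsWithin t T) (nhds (f t)) := hfc t ht
  have hg : Filter.Tendsto g (nhdsWithin t T) (nhds (g t)) := hgc t ht
  have hquot : Filter.Tendsto (fun s => f s / (g s * G)) (nhdsWithin t T)
      (nhds (f t / (g t * G))) := hf.div (hg.mul_const G) hne
  have hcoef : Filter.Tendsto (fun s => (Lf * g s - f s * Lg) / (g s * G)
      - (Lf * g t - f t * Lg) / (g t * G)) (nhdsWithin t T) (nhds 0) := by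
    have h := (((hg.const_mul Lf).sub (hf.mul_const Lg)).div (hg.mul_const G) hne).sub_const
      ((Lf * g t - f t * Lg) / (g t * G))
    rwa [sub_self] at h
  have hquotB := (hquot.isBigO_one ℝ).mul_isLittleO hdg
  have hcoefd := ((Asymptotics.isLittleO_one_iff ℝ).2 hcoef).mul_isBigO
    (Asymptotics.isBigO_refl (fun s => tsSigma T t - s) (nhdsWithin t T))
  simp only [one_mul] at hquotB hcoefd
  refine (((hdf.const_mul_left G⁻¹).sub hquotB).add hcoefd).congr' ?_ Filter.EventuallyEq.rfl
  filter_upwards [hg.eventually_ne hgt] with s hs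
  simp only [G] at hG ⊢
  field_simp
  ring
end

section
/- Let 𝕋 be a time scale, α ∈ (0,1], c ∈ ℝ, and m ∈ ℕ with m ≥ 1. If g : 𝕋 → ℝ is defined by g(t) = 1/(t − c)^m, then for every t ∈ 𝕋 with t > 0 and (t − c)·(σ(t) − c) ≠ 0, g is conformable fractional differentiable of order α at t with T_α(g)(t) = −t^{1−α} · Σ_{p=0}^{m−1} 1/((σ(t) − c)^{p+1}·(t − c)^{m−p}). -/
open Real Filter Set
open scoped Classical

theorem one_div_pow_sub_one_div_pow {a b : ℝ} (ha : a ≠ 0) (hb : b ≠ 0) (m : ℕ) :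
    1 / a ^ m - 1 / b ^ m =
      -((∑ p ∈ Finset.range m, 1 / (a ^ (p + 1) * b ^ (m - p))) * (a - b)) := by
  have hsum : ∑ p ∈ Finset.range m, 1 / (a ^ (p + 1) * b ^ (m - p)) =
      (∑ p ∈ Finset.range m, a⁻¹ ^ p * b⁻¹ ^ (m - 1 - p)) * (a⁻¹ * b⁻¹) := by
    rw [Finset.sum_mul]
    refine Finset.sum_congr rfl fun p hp => ?_
    have hp' : m - p = m - 1 - p + 1 := by
      have := Finset.mem_range.mp hp
      omega
    rw [hp', inv_pow, inv_pow, pow_succ, pow_succ]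
    field_simp
  have hsub : a⁻¹ * b⁻¹ * (a - b) = -(a⁻¹ - b⁻¹) := by
    field_simp
    ring
  rw [hsum, mul_assoc, hsub, mul_neg, neg_neg, geom_sum₂_mul]
  simp only [one_div, inv_pow]

theorem stmt14 (T : Set ℝ) (hTne : T.Nonempty) (hTcl : IsClosed T)
    (α : ℝ) (hα : α ∈ Set.Ioc (0 : ℝ) 1)
    (c : ℝ) (m : ℕ) (hm : 1 ≤ m)
    (g : ℝ → ℝ) (hg : ∀ x, g x = 1 / (x - c) ^ m)
    (t : ℝ) (ht : t ∈ T) (ht0 : 0 < t)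
    (hne : (t - c) * (tsSigma T t - c) ≠ 0) :
    HasConfDeriv T α g t
      (-(t ^ (1 - α) *
        ∑ p ∈ Finset.range m,
          1 / ((tsSigma T t - c) ^ (p + 1) * (t - c) ^ (m - p)))) := by
  obtain ⟨htc, hσc⟩ := mul_ne_zero_iff.mp hne
  set σ := tsSigma T t
  let F : ℝ → ℝ := fun s =>
    t ^ (1 - α) * ∑ p ∈ Finset.range m, 1 / ((σ - c) ^ (p + 1) * (s - c) ^ (m - p))
  have hF : ContinuousAt F t := by
    refine continuousAt_const.mul (tendsto_finsetSum _ fun p _ => ?_)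
    have hden : ContinuousAt (fun s => (σ - c) ^ (p + 1) * (s - c) ^ (m - p)) t := by
      fun_prop
    exact continuousAt_const.div hden (mul_ne_zero (pow_ne_zero _ hσc) (pow_ne_zero _ htc))
  intro ε hε
  obtain ⟨δ, hδ, hFδ⟩ := Metric.continuousAt_iff.mp hF ε hε
  refine ⟨min δ |t - c|, lt_min hδ (abs_pos.mpr htc), fun s _ hs => ?_⟩
  have hsc : s - c ≠ 0 := by
    intro h
    rw [sub_eq_zero.mp h] at hs
    exact lt_irrefl _ (hs.trans_le (min_le_right _ _))
  have hFs : |F s - F t| < ε := by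
    rw [← Real.dist_eq]
    refine hFδ ?_
    rw [dist_comm, Real.dist_eq]
    exact hs.trans_le (min_le_left _ _)
  have key : (g σ - g s) * t ^ (1 - α) - -F t * (σ - s) = -(F s - F t) * (σ - s) := by
    rw [hg, hg, one_div_pow_sub_one_div_pow hσc hsc]
    simp only [F]
    ring
  change |(g σ - g s) * t ^ (1 - α) - -F t * (σ - s)| ≤ ε * |σ - s|
  rw [key, abs_mul, abs_neg]
  exact mul_le_mul_of_nonneg_right hFs.le (abs_nonneg _)
end

section
/- Let 𝕋 be a time scale, α ∈ (0,1], and a, b ∈ 𝕋 with 0 < a < b. Suppose f : 𝕋 → ℝ is continuous on [a, b] ∩ 𝕋 (in the subspace topology of 𝕋) and, for every t ∈ [a, b) ∩ 𝕋, f is conformable fractional differentiable of order α at t with T_α(f)(t) ≥ 0. Then f is nondecreasing on [a, b] ∩ 𝕋: for all s, t ∈ [a, b] ∩ 𝕋 with s ≤ t, one has f(s) ≤ f(t). -/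
open Real Filter Set
open scoped Classical

/-- At a point `c` of a closed time scale which is not its maximum, a nonnegative conformable
derivative yields later points of the time scale at which `f` has decreased at a rate at most
`ε`. -/
theorem HasConfDeriv.exists_gt_sub_le {T : Set ℝ} (hT : IsClosed T) {α : ℝ} {f : ℝ → ℝ}
    {c t L : ℝ} (hc : c ∈ T) (hc0 : 0 < c) (ht : t ∈ T) (hct : c < t) (hL : 0 ≤ L)
    (h : HasConfDeriv T α f c L) {ε : ℝ} (hε : 0 < ε) :
    ∃ r ∈ T, c < r ∧ r ≤ t ∧ f c - ε * (r - c) ≤ f r := by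
  have hk : 0 < c ^ (1 - α) := rpow_pos_of_pos hc0 _
  obtain ⟨δ, hδ, hs⟩ := h (ε * c ^ (1 - α)) (by positivity)
  have hne : {s | s ∈ T ∧ c < s}.Nonempty := ⟨t, ht, hct⟩
  have hbdd : BddBelow {s | s ∈ T ∧ c < s} := ⟨c, fun x hx => hx.2.le⟩
  have hσ : tsSigma T c = sInf {s | s ∈ T ∧ c < s} := if_pos hne
  have hσT : tsSigma T c ∈ T := by
    rw [hσ]
    exact closure_minimal (fun x hx => hx.1) hT (csInf_mem_closure hne hbdd)
  have hcσ : c ≤ tsSigma T c := hσ ▸ le_csInf hne fun x hx => hx.2.le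
  rcases hcσ.eq_or_lt with heq | hlt
  · obtain ⟨r, ⟨hrT, hcr⟩, hrδ⟩ :=
      exists_lt_of_csInf_lt hne (show sInf {s | s ∈ T ∧ c < s} < min t (c + δ) by
        rw [← hσ, ← heq]; exact lt_min hct (by linarith))
    refine ⟨r, hrT, hcr, (hrδ.trans_le (min_le_left _ _)).le, ?_⟩
    have hr := hs r hrT (by
      rw [abs_sub_comm, abs_of_pos (sub_pos.2 hcr)]
      linarith [hrδ.trans_le (min_le_right _ _)])
    rw [← heq, abs_sub_comm c r, abs_of_pos (sub_pos.2 hcr)] at hr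
    have := (abs_le.1 hr).2
    have hLr : 0 ≤ L * (r - c) := mul_nonneg hL (sub_pos.2 hcr).le
    refine le_of_mul_le_mul_right ?_ hk
    linarith
  · refine ⟨tsSigma T c, hσT, hlt, hσ ▸ csInf_le hbdd ⟨ht, hct⟩, ?_⟩
    have hr := hs c hc (by simpa using hδ)
    rw [abs_of_pos (sub_pos.2 hlt)] at hr
    have := (abs_le.1 hr).1
    have hLr : 0 ≤ L * (tsSigma T c - c) := mul_nonneg hL (sub_pos.2 hlt).le
    refine le_of_mul_le_mul_right ?_ hk
    linarith

theorem stmt18 (T : Set ℝ) (hTne : T.Nonempty) (hTcl : IsClosed T)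
    (α : ℝ) (hα : α ∈ Set.Ioc (0 : ℝ) 1)
    (a b : ℝ) (ha : a ∈ T) (hb : b ∈ T) (h0a : 0 < a) (hab : a < b)
    (f : ℝ → ℝ) (hfc : ContinuousOn f (Set.Icc a b ∩ T))
    (hd : ∀ t ∈ Set.Ico a b ∩ T, ∃ L, 0 ≤ L ∧ HasConfDeriv T α f t L) :
    ∀ s ∈ Set.Icc a b ∩ T, ∀ t ∈ Set.Icc a b ∩ T, s ≤ t → f s ≤ f t := by
  intro s hs t ht hst
  suffices h : ∀ ε > 0, f s - ε * (t - s) ≤ f t by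
    have hlim : Tendsto (fun ε : ℝ => f s - ε * (t - s)) (nhdsWithin 0 (Ioi 0)) (nhds (f s)) := by
      have hcont : Continuous fun ε : ℝ => f s - ε * (t - s) := by fun_prop
      simpa using (hcont.tendsto 0).mono_left nhdsWithin_le_nhds
    exact le_of_tendsto hlim (eventually_mem_nhdsWithin.mono h)
  intro ε hε
  have hsub : Icc s t ∩ T ⊆ Icc a b ∩ T :=
    inter_subset_inter_left _ (Icc_subset_Icc hs.1.1 ht.1.2)
  have hcpt : IsCompact {r ∈ Icc s t ∩ T | f s - ε * (r - s) ≤ f r} :=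
    (isCompact_Icc.inter_right hTcl).of_isClosed_subset
      ((isClosed_Icc.inter hTcl).isClosed_le (by fun_prop) (hfc.mono hsub)) (sep_subset _ _)
  obtain ⟨c, ⟨hc, hfc'⟩, hmax⟩ := hcpt.exists_isGreatest ⟨s, ⟨⟨le_rfl, hst⟩, hs.2⟩, by simp⟩
  rcases hc.1.2.eq_or_lt with rfl | hct
  · exact hfc'
  · have hac : a ≤ c := hs.1.1.trans hc.1.1
    obtain ⟨L, hL, hder⟩ := hd c ⟨⟨hac, hct.trans_le ht.1.2⟩, hc.2⟩
    obtain ⟨r, hrT, hcr, hrt, hfr⟩ :=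
      hder.exists_gt_sub_le hTcl hc.2 (h0a.trans_le hac) ht.2 hct hL hε
    have hrc : r ≤ c := hmax ⟨⟨⟨hc.1.1.trans hcr.le, hrt⟩, hrT⟩, by linarith⟩
    exact absurd hcr hrc.not_gt
end
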